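/- Let Λ be the completed preprojective algebra of a non-Dynkin graph and W its Coxeter group. The families of two-term tilting complexes {P_w}_{w∈W} (minimal projective presentations of the tilting modules I_w) and {R_w}_{w∈W} (shifted duals of minimal projective presentations of I_w as right modules) are disjoint: P_w ≇ R_v for all v, w ∈ W. -/

import Mathlib

set_option linter.unusedSectionVars false

section PathAlgebra

variable {K : Type} [Field K] {ι : Type} [Fintype ι] [LinearOrder ι]

/-- Paths in the double quiver of the graph with `m i j` edges between `i` and `j`. -/
inductive Pth (m : ι → ι → ℕ) : ι → ι → Type
  | nil (i : ι) : Pth m i i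
  | cons {i j k : ι} (a : Fin (m i j)) (p : Pth m j k) : Pth m i k

/-- The length of a path. -/
def Pth.len {m : ι → ι → ℕ} : ∀ {i j : ι}, Pth m i j → ℕ
  | _, _, .nil _ => 0
  | _, _, .cons _ p => p.len + 1

variable {m : ι → ι → ℕ}

/-- Convolution helper: `go g i F k p` is the coefficient at `p` of the product `F * g` where
`F` is a family of coefficients for paths starting at `i`. -/
def go (g : ∀ i j : ι, Pth m i j → K) : ∀ (i : ι), (∀ j, Pth m i j → K) → ∀ (k : ι), Pth m i k → K
  | i, F, _, .nil _ => F i (.nil i) * g i i (.nil i)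
  | i, F, k, .cons (j := j) a p =>
      F i (.nil i) * g i k (.cons a p) + go g j (fun j' q => F j' (.cons a q)) k p

lemma go_congrF (g : ∀ i j : ι, Pth m i j → K) {i k : ι} {F F' : ∀ j, Pth m i j → K}
    (h : ∀ j q, F j q = F' j q) (p : Pth m i k) : go g i F k p = go g i F' k p := by
  have : F = F' := funext fun j => funext (h j)
  rw [this]

lemma go_addF (g : ∀ i j : ι, Pth m i j → K) :
    ∀ {i k : ι} (F F' : ∀ j, Pth m i j → K) (p : Pth m i k),
    go g i (fun j q => F j q + F' j q) k p = go g i F k p + go g i F' k p := by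
  intro i k F F' p
  induction p with
  | nil i => simp [go, add_mul]
  | cons a p ih =>
      simp only [go]
      rw [ih]
      ring

lemma go_mulF (g : ∀ i j : ι, Pth m i j → K) (c : K) :
    ∀ {i k : ι} (F : ∀ j, Pth m i j → K) (p : Pth m i k),
    go g i (fun j q => c * F j q) k p = c * go g i F k p := by
  intro i k F p
  induction p with
  | nil i => simp [go]; ring
  | cons a p ih =>
      simp only [go]
      rw [ih]
      ring

lemma go_zeroF (g : ∀ i j : ι, Pth m i j → K) : ∀ {i k : ι} (p : Pth m i k),
    go g i (fun _ _ => (0 : K)) k p = 0 := by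
  intro i k p
  induction p with
  | nil i => simp [go]
  | cons a p ih => simp [go, ih]

lemma go_addg (g g' : ∀ i j : ι, Pth m i j → K) :
    ∀ {i k : ι} (F : ∀ j, Pth m i j → K) (p : Pth m i k),
    go (fun i j q => g i j q + g' i j q) i F k p = go g i F k p + go g' i F k p := by
  intro i k F p
  induction p with
  | nil i => simp [go]; ring
  | cons a p ih =>
      simp only [go]
      rw [ih]
      ring

lemma go_zerog : ∀ {i k : ι} (F : ∀ j, Pth m i j → K) (p : Pth m i k),
    go (fun _ _ _ => (0 : K)) i F k p = 0 := by
  intro i k F p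
  induction p with
  | nil i => simp [go]
  | cons a p ih => simp [go, ih]

/-- Raw convolution product. -/
def mulRaw (f g : ∀ i j : ι, Pth m i j → K) : ∀ i j : ι, Pth m i j → K :=
  fun i k p => go g i (f i) k p

lemma go_assoc (g h : ∀ i j : ι, Pth m i j → K) :
    ∀ {i l : ι} (F : ∀ j, Pth m i j → K) (r : Pth m i l),
    go h i (fun k p => go g i F k p) l r = go (mulRaw g h) i F l r := by
  intro i l F r
  induction r with
  | nil i => simp [go, mulRaw, mul_assoc]
  | cons a r ih =>
      rename_i i0 j0 l0
      simp only [go, mulRaw]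
      rw [go_congrF h (F' := fun k p => F i0 (.nil i0) * g i0 k (.cons a p) +
            go g j0 (fun j' q => F j' (.cons a q)) k p) (fun k p => by simp only [go])]
      rw [go_addF h, go_mulF h, ih]
      ring

lemma go_oneF (f : ∀ i j : ι, Pth m i j → K) : ∀ {i k : ι} (p : Pth m i k),
    go f i (fun j q => (match q with | .nil _ => (1 : K) | .cons _ _ => 0 : K)) k p
      = f i k p := by
  intro i k p
  induction p with
  | nil i => simp [go]
  | cons a p ih =>
      simp only [go]
      rw [go_congrF f (F' := fun _ _ => (0 : K)) (fun j q => rfl), go_zeroF]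
      ring

lemma go_oneg : ∀ {i k : ι} (F : ∀ j, Pth m i j → K) (p : Pth m i k),
    go (fun _ _ q => (match q with | .nil _ => (1 : K) | .cons _ _ => 0 : K)) i F k p
      = F k p := by
  intro i k F p
  induction p with
  | nil i => simp [go]
  | cons a p ih => simp [go, ih]

/-- The complete path algebra of the double quiver of the graph `m`: formal possibly infinite
`K`-linear combinations of paths. -/
@[ext]
structure PreE (K : Type) [Field K] {ι : Type} (m : ι → ι → ℕ) where
  coeff : ∀ i j : ι, Pth m i j → K

namespace PreE

instance : Zero (PreE K m) := ⟨⟨fun _ _ _ => 0⟩⟩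
instance : Add (PreE K m) := ⟨fun f g => ⟨fun i j p => f.coeff i j p + g.coeff i j p⟩⟩
instance : Neg (PreE K m) := ⟨fun f => ⟨fun i j p => -f.coeff i j p⟩⟩
instance : One (PreE K m) :=
  ⟨⟨fun _ _ q => (match q with | .nil _ => (1 : K) | .cons _ _ => 0 : K)⟩⟩
instance : Mul (PreE K m) := ⟨fun f g => ⟨mulRaw f.coeff g.coeff⟩⟩

instance instRing : Ring (PreE K m) :=
  Ring.ofMinimalAxioms
    (fun a b c => by ext i j p; exact add_assoc _ _ _)
    (fun a => by ext i j p; exact zero_add _)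
    (fun a => by ext i j p; exact neg_add_cancel _)
    (fun a b c => by
      ext i l r
      exact go_assoc b.coeff c.coeff (a.coeff i) r)
    (fun a => by ext i k p; exact go_oneF a.coeff p)
    (fun a => by ext i k p; exact go_oneg (a.coeff i) p)
    (fun a b c => by
      ext i k p
      exact go_addg b.coeff c.coeff (a.coeff i) p)
    (fun a b c => by
      ext i k p
      exact go_addF c.coeff (a.coeff i) (b.coeff i) p)

end PreE

end PathAlgebra

section Preprojective

variable (K : Type) [Field K] {ι : Type} [Fintype ι] [LinearOrder ι]

/-- The preprojective relation `ρ = Σ_{α ∈ Q₁} (α α* - α* α)`, an element of the complete path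
algebra: it assigns to each two-cycle `i → j → i` through matching dual arrows the
coefficient `+1` if `i < j` and `-1` if `j < i`. -/
def rho (m : ι → ι → ℕ) : PreE K m :=
  ⟨fun i k p =>
    match p with
    | .nil _ => 0
    | .cons (j := j) a q =>
        match q with
        | .nil _ => 0
        | .cons b q' =>
            match q' with
            | .cons _ _ => 0
            | .nil _ =>
                if k = i then
                  (if (a : ℕ) = (b : ℕ) then (if i < j then (1 : K) else -1) else 0)
                else 0⟩

/-- The two-sided ideal generated by the preprojective relation. -/
def relIdeal (m : ι → ι → ℕ) : TwoSidedIdeal (PreE K m) :=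
  TwoSidedIdeal.span {rho K m}

/-- The closure of the preprojective ideal with respect to the arrow-adic topology. -/
def relClosure (m : ι → ι → ℕ) : Set (PreE K m) :=
  {f | ∀ n : ℕ, ∃ g ∈ relIdeal K m, ∀ (i j : ι) (p : Pth m i j),
    p.len < n → f.coeff i j p = g.coeff i j p}

/-- The congruence defining the complete preprojective algebra. -/
def ppCon (m : ι → ι → ℕ) : RingCon (PreE K m) :=
  ringConGen (fun x y => x - y ∈ relClosure K m)

/-- The complete preprojective algebra of the graph `m`. -/
def PPA (m : ι → ι → ℕ) : Type := (ppCon K m).Quotient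

instance (m : ι → ι → ℕ) : Ring (PPA K m) :=
  inferInstanceAs (Ring (ppCon K m).Quotient)

/-- The idempotent `e_i` of the complete preprojective algebra. -/
def eIdem (m : ι → ι → ℕ) (i : ι) : PPA K m :=
  (ppCon K m).mk'
    ⟨fun _ _ p => match p with
      | .nil v => if v = i then (1 : K) else 0
      | .cons _ _ => 0⟩

/-- The tilting ideal `I_i = Λ(1 - e_i)Λ`. -/
def Igen (m : ι → ι → ℕ) (i : ι) : TwoSidedIdeal (PPA K m) :=
  TwoSidedIdeal.span {1 - eIdem K m i}

/-- The product of two two-sided ideals. -/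
def tmul {R : Type} [Ring R] (I J : TwoSidedIdeal R) : TwoSidedIdeal R :=
  TwoSidedIdeal.span {x | ∃ a ∈ I, ∃ b ∈ J, x = a * b}

/-- The product ideal `I_{i_1} ⋯ I_{i_l}` associated to a word in the vertices;
the empty word gives `I_id = Λ`. -/
def prodI (m : ι → ι → ℕ) (l : List ι) : TwoSidedIdeal (PPA K m) :=
  l.foldr (fun i acc => tmul (Igen K m i) acc) ⊤

end Preprojective

section TwoTerm

variable (Λ : Type) [Ring Λ]

/-- The radical `rad M = (rad Λ)M` of a module. -/
def radSub (M : Type) [AddCommGroup M] [Module Λ M] : Submodule Λ M :=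
  Submodule.span Λ {x : M | ∃ r ∈ Ideal.jacobson (⊥ : Ideal Λ), ∃ y : M, x = r • y}

/-- A homotopy equivalence between the two-term complexes `(A¹ --dA--> A⁰)` and
`(B¹ --dB--> B⁰)` (concentrated in degrees `-1, 0`); this is the same as an isomorphism in
`K^b(proj Λ)` for two-term complexes. -/
def TwoTermHtpyEquiv (A1 A0 B1 B0 : Type)
    [AddCommGroup A1] [Module Λ A1] [AddCommGroup A0] [Module Λ A0]
    [AddCommGroup B1] [Module Λ B1] [AddCommGroup B0] [Module Λ B0]
    (dA : A1 →ₗ[Λ] A0) (dB : B1 →ₗ[Λ] B0) : Prop :=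
  ∃ (u1 : A1 →ₗ[Λ] B1) (u0 : A0 →ₗ[Λ] B0) (v1 : B1 →ₗ[Λ] A1) (v0 : B0 →ₗ[Λ] A0)
    (s : A0 →ₗ[Λ] A1) (t : B0 →ₗ[Λ] B1),
    dB ∘ₗ u1 = u0 ∘ₗ dA ∧ dA ∘ₗ v1 = v0 ∘ₗ dB ∧
    v1 ∘ₗ u1 - LinearMap.id = s ∘ₗ dA ∧ v0 ∘ₗ u0 - LinearMap.id = dA ∘ₗ s ∧
    u1 ∘ₗ v1 - LinearMap.id = t ∘ₗ dB ∧ u0 ∘ₗ v0 - LinearMap.id = dB ∘ₗ t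

/-- The `Λ`-dual `Hom_{Λᵒᵖ}(-, Λ)` of a map of right `Λ`-modules, as a map of left
`Λ`-modules. -/
def dualMap {Q1 Q0 : Type} [AddCommGroup Q1] [Module Λᵐᵒᵖ Q1]
    [AddCommGroup Q0] [Module Λᵐᵒᵖ Q0] (g : Q1 →ₗ[Λᵐᵒᵖ] Q0) :
    (Q0 →ₗ[Λᵐᵒᵖ] Λ) →ₗ[Λ] (Q1 →ₗ[Λᵐᵒᵖ] Λ) where
  toFun φ := φ.comp g
  map_add' φ ψ := by ext x; simp
  map_smul' a φ := by ext x; simp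

end TwoTerm

section CoxeterFinite

variable {ι : Type} [Fintype ι] [LinearOrder ι]

/-- The symmetric bilinear form of the generalized Cartan matrix `2 - m`. -/
def cartanForm (m : ι → ι → ℕ) : LinearMap.BilinForm ℤ (ι → ℤ) :=
  Matrix.toBilin' (Matrix.of fun i j => (if i = j then 2 else 0) - (m i j : ℤ))

lemma cartanForm_apply (m : ι → ι → ℕ) (y z : ι → ℤ) :
    cartanForm m y z = 2 * ∑ i, y i * z i - ∑ i, ∑ j, (m i j : ℤ) * y i * z j := by
  simp only [cartanForm, Matrix.toBilin'_apply, Matrix.of_apply, mul_sub, sub_mul,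
    Finset.sum_sub_distrib, Finset.mul_sum]
  congr 1
  · refine Finset.sum_congr rfl fun i _ => ?_
    simp
    ring
  · refine Finset.sum_congr rfl fun i _ => Finset.sum_congr rfl fun j _ => ?_
    ring

lemma cartanForm_single (m : ι → ι → ℕ) (i j : ι) :
    cartanForm m (Pi.single i 1) (Pi.single j 1) = (if i = j then 2 else 0) - (m i j : ℤ) := by
  simp [cartanForm, Matrix.toBilin'_single]

lemma cartanForm_comm {m : ι → ι → ℕ} (hsymm : ∀ i j, m i j = m j i) (y z : ι → ℤ) :
    cartanForm m y z = cartanForm m z y := by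
  rw [cartanForm_apply, cartanForm_apply, Finset.sum_comm]
  congr 1
  · simp only [mul_comm]
  · refine Finset.sum_congr rfl fun i _ => Finset.sum_congr rfl fun j _ => ?_
    rw [hsymm]
    ring

/-- The simple reflection on the root lattice. -/
def simpleRefl (m : ι → ι → ℕ) (i : ι) : Module.End ℤ (ι → ℤ) :=
  LinearMap.id - (cartanForm m (Pi.single i 1)).smulRight (Pi.single i 1)

lemma simpleRefl_apply (m : ι → ι → ℕ) (i : ι) (y : ι → ℤ) :
    simpleRefl m i y = y - cartanForm m (Pi.single i 1) y • Pi.single i 1 := rfl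

lemma simpleRefl_isometry {m : ι → ι → ℕ} (hsymm : ∀ i j, m i j = m j i)
    (hloop : ∀ i, m i i = 0) (i : ι) (y : ι → ℤ) :
    cartanForm m (simpleRefl m i y) (simpleRefl m i y) = cartanForm m y y := by
  have h2 := cartanForm_single m i i
  rw [if_pos rfl, hloop] at h2
  simp only [simpleRefl_apply, map_sub, LinearMap.sub_apply, map_smul, LinearMap.smul_apply, h2,
    cartanForm_comm hsymm y (Pi.single i 1), smul_eq_mul]
  push_cast
  ring

/-- The simple reflections satisfy the Coxeter relations. -/
lemma simpleRefl_isLiftable {m : ι → ι → ℕ} (hsymm : ∀ i j, m i j = m j i)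
    (hloop : ∀ i, m i i = 0) {Mc : CoxeterMatrix ι}
    (hMc : ∀ i j, i ≠ j → Mc i j = if m i j = 0 then 2 else if m i j = 1 then 3 else 0) :
    Mc.IsLiftable (simpleRefl m) := by
  intro i j
  have hself : ∀ k, cartanForm m (Pi.single k 1) (Pi.single k 1) = 2 := fun k => by
    simp [cartanForm_single, hloop]
  by_cases hij : i = j
  · subst hij
    refine LinearMap.ext fun y => ?_
    simp only [Mc.diagonal, pow_one, Module.End.mul_apply, simpleRefl_apply, map_sub, map_smul,
      hself, Module.End.one_apply]
    module
  · have h1 : cartanForm m (Pi.single i 1) (Pi.single j 1) = -(m i j : ℤ) := by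
      simp [cartanForm_single, hij]
    have h2 : cartanForm m (Pi.single j 1) (Pi.single i 1) = -(m i j : ℤ) := by
      rw [cartanForm_comm hsymm, h1]
    rw [hMc i j hij]
    split_ifs with h h'
    · refine LinearMap.ext fun y => ?_
      simp only [pow_succ, pow_zero, one_mul, Module.End.mul_apply, simpleRefl_apply, map_sub,
        map_smul, hself, Module.End.one_apply, h1, h2, h]
      module
    · refine LinearMap.ext fun y => ?_
      simp only [pow_succ, pow_zero, one_mul, Module.End.mul_apply, simpleRefl_apply, map_sub,
        map_smul, hself, Module.End.one_apply, h1, h2, h']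
      module
    · rw [pow_zero]

/-- In a simply laced Coxeter group acting on its root lattice, `w` sends `α_i` to a nonnegative
vector as soon as `i` is not a right descent of `w`. -/
lemma nonneg_of_not_isRightDescent {m : ι → ι → ℕ} (hsymm : ∀ i j, m i j = m j i)
    (hloop : ∀ i, m i i = 0) (hle : ∀ i j, m i j ≤ 1) {Mc : CoxeterMatrix ι}
    (hMc : ∀ i j, i ≠ j → Mc i j = if m i j = 0 then 2 else if m i j = 1 then 3 else 0)
    (ρ : Mc.Group →* Module.End ℤ (ι → ℤ)) (hρ : ∀ i, ρ (Mc.simple i) = simpleRefl m i)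
    (n : ℕ) : ∀ (w : Mc.Group) (i : ι), Mc.toCoxeterSystem.length w = n →
      ¬ Mc.toCoxeterSystem.IsRightDescent w i → 0 ≤ ρ w (Pi.single i 1) := by
  induction n using Nat.strong_induction_on with
  | _ n ih =>
  intro w i hn hi
  set cs := Mc.toCoxeterSystem with hcs
  have hs : ∀ i, cs.simple i = Mc.simple i := fun i => rfl
  by_cases hw : w = 1
  · subst hw
    rw [map_one, Module.End.one_apply]
    exact Pi.single_nonneg.2 zero_le_one
  obtain ⟨j, hj⟩ := cs.exists_rightDescent_of_ne_one hw
  have hij : i ≠ j := by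
    rintro rfl
    exact hi hj
  rw [cs.isRightDescent_iff] at hj
  rw [cs.not_isRightDescent_iff] at hi
  obtain ⟨u, rfl⟩ : ∃ u, w = u * cs.simple j := ⟨w * cs.simple j, by simp⟩
  rw [cs.simple_mul_simple_cancel_right] at hj
  have hrel := cs.simple_mul_simple_pow i j
  have hM := hMc i j hij
  have hji : cartanForm m (Pi.single j 1) (Pi.single i 1) = -(m i j : ℤ) := by
    simp [cartanForm_single, hij.symm, hsymm i j]
  have hji' : cartanForm m (Pi.single i 1) (Pi.single j 1) = -(m i j : ℤ) := by
    simp [cartanForm_single, hij]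
  rw [map_mul, hs, hρ, Module.End.mul_apply, simpleRefl_apply, hji]
  by_cases h0 : m i j = 0
  · rw [if_pos h0] at hM
    rw [hM] at hrel
    have hcomm : cs.simple j * cs.simple i = cs.simple i * cs.simple j := by
      rw [pow_two, mul_eq_one_iff_eq_inv] at hrel
      simpa using hrel.symm
    have h1 : cs.length (u * cs.simple i * cs.simple j) ≤ cs.length (u * cs.simple i) + 1 := by
      simpa using cs.length_mul_le (u * cs.simple i) (cs.simple j)
    rw [mul_assoc, hcomm, ← mul_assoc] at hi
    have h2 : ¬ cs.IsRightDescent u i := by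
      rw [CoxeterSystem.IsRightDescent]
      omega
    simpa [h0] using ih _ (by omega) u i rfl h2
  · have hm1 : m i j = 1 := le_antisymm (hle i j) (Nat.one_le_iff_ne_zero.2 h0)
    rw [if_neg h0, if_pos hm1] at hM
    rw [hM] at hrel
    have hbraid : cs.simple i * cs.simple j * cs.simple i =
        cs.simple j * cs.simple i * cs.simple j := by
      rw [pow_succ, pow_two, mul_assoc, mul_assoc, mul_assoc, ← mul_assoc, ← mul_assoc,
        mul_eq_one_iff_eq_inv] at hrel
      simpa [mul_assoc] using hrel
    have huj : ¬ cs.IsRightDescent u j := by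
      rw [cs.not_isRightDescent_iff, hj]
    by_cases hui : cs.IsRightDescent u i
    · obtain ⟨t, rfl⟩ : ∃ t, u = t * cs.simple i := ⟨u * cs.simple i, by simp⟩
      rw [cs.isRightDescent_iff, cs.simple_mul_simple_cancel_right] at hui
      have h1 : cs.length (t * cs.simple j * (cs.simple i * cs.simple j)) ≤
          cs.length (t * cs.simple j) + 2 := by
        refine (cs.length_mul_le _ _).trans (Nat.add_le_add_left ?_ _)
        simpa using cs.length_mul_le (cs.simple i) (cs.simple j)
      have h2 : t * cs.simple i * cs.simple j * cs.simple i =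
          t * cs.simple j * (cs.simple i * cs.simple j) := by
        simpa only [mul_assoc] using congrArg (t * ·) hbraid
      rw [h2] at hi
      have h3 : ¬ cs.IsRightDescent t j := by
        rw [CoxeterSystem.IsRightDescent]
        omega
      have h4 := ih _ (by omega) t j rfl h3
      rw [map_mul, hs, hρ, Module.End.mul_apply, simpleRefl_apply]
      have hii : cartanForm m (Pi.single i 1) (Pi.single i 1) = 2 := by
        simp [cartanForm_single, hloop]
      rw [map_sub (cartanForm m _), map_smul (cartanForm m _), hii, hji', hm1]
      convert h4 using 2
      push_cast
      module
    · have h1 := ih _ (by omega) u i rfl hui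
      have h2 := ih _ (by omega) u j rfl huj
      have : ρ u (Pi.single i 1 - (-(m i j : ℤ)) • Pi.single j 1) =
          ρ u (Pi.single i 1) + ρ u (Pi.single j 1) := by
        simp [hm1]
      rw [this]
      exact add_nonneg h1 h2

/-- A symmetric generalized Cartan matrix sending some positive vector to a positive vector is
positive definite, with an explicit lower bound. -/
lemma sum_sq_div_le_cartanForm {m : ι → ι → ℕ} (hsymm : ∀ i j, m i j = m j i)
    {x : ι → ℕ} (hx : ∀ i, 0 < x i) (hA : ∀ i, ∑ j, m i j * x j + 1 ≤ 2 * x i) (y : ι → ℤ) :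
    ∑ i, (y i : ℚ) ^ 2 / x i ≤ cartanForm m y y := by
  have hx' : ∀ i, (0 : ℚ) < x i := fun i => by exact_mod_cast hx i
  have key : ∀ i j, (m i j : ℚ) * y i * y j ≤
      (m i j : ℚ) * (x j / x i * y i ^ 2) / 2 + (m i j : ℚ) * (x i / x j * y j ^ 2) / 2 := by
    intro i j
    have h : (0 : ℚ) ≤ x i * x j * ((y i : ℚ) / x i - y j / x j) ^ 2 :=
      mul_nonneg (mul_nonneg (hx' i).le (hx' j).le) (sq_nonneg _)
    have h' : (x i : ℚ) * x j * ((y i : ℚ) / x i - y j / x j) ^ 2 =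
        x j / x i * y i ^ 2 + x i / x j * y j ^ 2 - 2 * (y i * y j) := by
      have := (hx' i).ne'
      have := (hx' j).ne'
      field_simp
      ring
    rw [h'] at h
    have hm : (0 : ℚ) ≤ m i j := Nat.cast_nonneg _
    nlinarith [mul_nonneg hm h]
  have hsum : ∑ i, ∑ j, (m i j : ℚ) * y i * y j ≤
      ∑ i, (y i : ℚ) ^ 2 / x i * ∑ j, (m i j : ℚ) * x j := by
    have hswap : ∑ i, ∑ j, (m i j : ℚ) * (x i / x j * y j ^ 2) / 2 =
        ∑ i, ∑ j, (m i j : ℚ) * (x j / x i * y i ^ 2) / 2 := by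
      rw [Finset.sum_comm]
      refine Finset.sum_congr rfl fun i _ => Finset.sum_congr rfl fun j _ => ?_
      rw [hsymm i j]
    calc ∑ i, ∑ j, (m i j : ℚ) * y i * y j
        ≤ ∑ i, ∑ j, ((m i j : ℚ) * (x j / x i * y i ^ 2) / 2
            + (m i j : ℚ) * (x i / x j * y j ^ 2) / 2) :=
          Finset.sum_le_sum fun i _ => Finset.sum_le_sum fun j _ => key i j
      _ = ∑ i, (y i : ℚ) ^ 2 / x i * ∑ j, (m i j : ℚ) * x j := by
          simp only [Finset.sum_add_distrib, hswap]
          simp only [← Finset.sum_add_distrib, Finset.mul_sum]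
          refine Finset.sum_congr rfl fun i _ => Finset.sum_congr rfl fun j _ => ?_
          ring
  have hrow : ∑ i, (y i : ℚ) ^ 2 / x i * ∑ j, (m i j : ℚ) * x j ≤
      ∑ i, (y i : ℚ) ^ 2 / x i * (2 * x i - 1) := by
    refine Finset.sum_le_sum fun i _ => mul_le_mul_of_nonneg_left ?_
      (div_nonneg (sq_nonneg _) (hx' i).le)
    have := hA i
    have h : (∑ j, (m i j : ℚ) * x j) + 1 ≤ 2 * x i := by exact_mod_cast this
    linarith
  have hfin : ∑ i, (y i : ℚ) ^ 2 / x i * (2 * x i - 1) =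
      2 * ∑ i, (y i : ℚ) * y i - ∑ i, (y i : ℚ) ^ 2 / x i := by
    rw [Finset.mul_sum, ← Finset.sum_sub_distrib]
    refine Finset.sum_congr rfl fun i _ => ?_
    have := (hx' i).ne'
    field_simp
  rw [cartanForm_apply]
  push_cast
  linarith

/-- If the generalized Cartan matrix `2 - m` sends some positive vector to a positive vector,
then the Coxeter group of `m` is finite. -/
theorem finite_coxeterGroup_of_pos {m : ι → ι → ℕ} (hsymm : ∀ i j, m i j = m j i)
    (hloop : ∀ i, m i i = 0) {Mc : CoxeterMatrix ι}
    (hMc : ∀ i j, i ≠ j → Mc i j = if m i j = 0 then 2 else if m i j = 1 then 3 else 0)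
    {x : ι → ℕ} (hx : ∀ i, 0 < x i) (hA : ∀ i, ∑ j, m i j * x j + 1 ≤ 2 * x i) :
    Finite Mc.Group := by
  have hle : ∀ i j, m i j ≤ 1 := by
    intro i j
    by_contra! h
    have h1 : m i j * x j ≤ ∑ k, m i k * x k :=
      Finset.single_le_sum (f := fun k => m i k * x k) (fun _ _ => Nat.zero_le _)
        (Finset.mem_univ j)
    have h2 : m j i * x i ≤ ∑ k, m j k * x k :=
      Finset.single_le_sum (f := fun k => m j k * x k) (fun _ _ => Nat.zero_le _)
        (Finset.mem_univ i)
    have h3 := hA i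
    have h4 := hA j
    rw [hsymm j i] at h2
    have h5 := Nat.mul_le_mul_right (x j) h
    have h6 := Nat.mul_le_mul_right (x i) h
    simp only [Nat.succ_eq_add_one] at h5 h6
    omega
  set cs := Mc.toCoxeterSystem with hcs
  let ρ : Mc.Group →* Module.End ℤ (ι → ℤ) :=
    cs.lift ⟨simpleRefl m, simpleRefl_isLiftable hsymm hloop hMc⟩
  have hρ : ∀ i, ρ (cs.simple i) = simpleRefl m i := fun i => cs.lift_apply_simple _ i
  have hiso : ∀ w y, cartanForm m (ρ w y) (ρ w y) = cartanForm m y y := by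
    intro w
    induction w using cs.simple_induction_left with
    | one => simp
    | mul_simple_left w i ih =>
      intro y
      rw [map_mul, hρ, Module.End.mul_apply, simpleRefl_isometry hsymm hloop, ih]
  have hker : ∀ w, (∀ i, ρ w (Pi.single i 1) = Pi.single i 1) → w = 1 := by
    intro w hw
    by_contra hne
    obtain ⟨i, hi⟩ := cs.exists_rightDescent_of_ne_one hne
    rw [cs.isRightDescent_iff_not_isRightDescent_mul] at hi
    have h := nonneg_of_not_isRightDescent hsymm hloop hle hMc ρ hρ _ _ i rfl hi i
    rw [map_mul, hρ, Module.End.mul_apply, simpleRefl_apply, map_sub, map_smul, hw] at h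
    simp [cartanForm_single, hloop] at h
  let R : Set (ι → ℤ) := {y | cartanForm m y y = 2}
  have hR : R.Finite := by
    refine (Set.finite_Icc (fun i => -(2 * x i : ℤ)) (fun i => (2 * x i : ℤ))).subset ?_
    intro y hy
    have hb : ∀ i, |y i| ≤ 2 * x i := by
      intro i
      have hx' : ∀ i, (0 : ℚ) < x i := fun i => by exact_mod_cast hx i
      have h1 := sum_sq_div_le_cartanForm hsymm hx hA y
      have h2 : (y i : ℚ) ^ 2 / x i ≤ ∑ i, (y i : ℚ) ^ 2 / x i :=
        Finset.single_le_sum (f := fun i => (y i : ℚ) ^ 2 / x i)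
          (fun i _ => div_nonneg (sq_nonneg _) (hx' i).le) (Finset.mem_univ i)
      rw [show cartanForm m y y = 2 from hy] at h1
      have h3 := (div_le_iff₀ (hx' i)).1 (h2.trans h1)
      have h4 : y i ^ 2 ≤ 2 * x i := by exact_mod_cast h3
      have h5 := Int.natAbs_le_self_sq (y i)
      have h6 : ((y i).natAbs : ℤ) = |y i| := Int.natCast_natAbs _
      omega
    exact ⟨fun i => (abs_le.1 (hb i)).1, fun i => (abs_le.1 (hb i)).2⟩
  have : Finite R := hR
  refine Finite.of_injective (β := ι → R)
    (fun w i => ⟨ρ w (Pi.single i 1), by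
      change cartanForm m _ _ = 2
      rw [hiso]
      simp [cartanForm_single, hloop]⟩) ?_
  intro w w' h
  have h' : ∀ i, ρ w (Pi.single i 1) = ρ w' (Pi.single i 1) := fun i =>
    congrArg Subtype.val (congrFun h i)
  have h1 : w⁻¹ * w' = 1 := by
    refine hker _ fun i => ?_
    rw [map_mul, Module.End.mul_apply, ← h', ← Module.End.mul_apply, ← map_mul, inv_mul_cancel,
      map_one, Module.End.one_apply]
  exact inv_mul_eq_one.1 h1

end CoxeterFinite

section PathFunctionals

variable {K : Type} [Field K] {ι : Type} [Fintype ι] [LinearOrder ι] {m : ι → ι → ℕ}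

namespace PreE

lemma coeff_add (f g : PreE K m) (i : ι) : (f + g).coeff i = f.coeff i + g.coeff i := rfl

lemma coeff_neg (f : PreE K m) (i : ι) : (-f).coeff i = -f.coeff i := rfl

lemma coeff_zero (i : ι) : (0 : PreE K m).coeff i = 0 := rfl

lemma coeff_mul (f g : PreE K m) (i : ι) :
    (f * g).coeff i = go g.coeff i (f.coeff i) := rfl

end PreE

/-- The space of functions on the paths starting at `i`. -/
abbrev PathFun (K : Type) [Field K] {ι : Type} (m : ι → ι → ℕ) (i : ι) : Type :=
  ∀ j, Pth m i j → K

/-- Evaluation at the trivial path. -/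
def evalNil (i : ι) : PathFun K m i →ₗ[K] K :=
  LinearMap.proj (Pth.nil i) ∘ₗ LinearMap.proj i

/-- The function `q ↦ c (a q)` on paths starting at the target of `a`. -/
def shift {i j : ι} (a : Fin (m i j)) : PathFun K m i →ₗ[K] PathFun K m j where
  toFun c := fun k p => c k (.cons a p)
  map_add' _ _ := rfl
  map_smul' _ _ := rfl

lemma PathFun.ext_shift {i : ι} {c c' : PathFun K m i} (h0 : evalNil i c = evalNil i c')
    (h : ∀ j (a : Fin (m i j)), shift a c = shift a c') : c = c' := by
  funext k p
  cases p with
  | nil => exact h0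
  | cons a p => exact congrFun (congrFun (h _ a) k) p

/-- The function on paths starting at `i` that vanishes at the trivial path and has
prescribed shifts. -/
def consFun : ∀ {i : ι}, (∀ j, Fin (m i j) → PathFun K m j) → PathFun K m i
  | _, _, _, .nil _ => 0
  | _, t, _, .cons a q => t _ a _ q

/-- `consFun` as a linear map. -/
def consLin (i : ι) : (∀ j, Fin (m i j) → PathFun K m j) →ₗ[K] PathFun K m i where
  toFun t := consFun t
  map_add' t t' := by
    refine PathFun.ext_shift ?_ fun j a => rfl
    exact (add_zero (0 : K)).symm
  map_smul' r t := by
    refine PathFun.ext_shift ?_ fun j a => rfl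
    exact (mul_zero r).symm

/-- The sign of an arrow `i → j` in the preprojective relation. -/
def arrowSign (K : Type) [Field K] (i j : ι) : K := if i < j then 1 else -1

/-- Contraction of a function on paths starting at `i` with the preprojective relation at `i`. -/
def relMap (hsymm : ∀ i j, m i j = m j i) (i : ι) : PathFun K m i →ₗ[K] PathFun K m i :=
  ∑ j, ∑ a : Fin (m i j), arrowSign K i j • (shift (Fin.cast (hsymm i j) a) ∘ₗ shift a)

lemma relMap_apply (hsymm : ∀ i j, m i j = m j i) (i : ι) (c : PathFun K m i) :
    relMap hsymm i c =
      ∑ j, ∑ a : Fin (m i j), arrowSign K i j • shift (Fin.cast (hsymm i j) a) (shift a c) := by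
  simp [relMap, LinearMap.sum_apply]

/-- The functions supported on the paths of length `d` starting at `i` that vanish on the
preprojective ideal, i.e. the dual of the degree `d` part of `e_i Λ`. -/
def dualPiece (K : Type) [Field K] (hsymm : ∀ i j, m i j = m j i) :
    ℕ → ∀ i, Submodule K (PathFun K m i)
  | 0, _ => ⨅ j, ⨅ a : Fin (m _ j), LinearMap.ker (shift a)
  | d + 1, i => LinearMap.ker (evalNil i) ⊓ LinearMap.ker (relMap hsymm i) ⊓
      ⨅ j, ⨅ a : Fin (m i j), (dualPiece K hsymm d j).comap (shift a)

lemma mem_dualPiece_zero {hsymm : ∀ i j, m i j = m j i} {i : ι} {c : PathFun K m i} :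
    c ∈ dualPiece K hsymm 0 i ↔ ∀ j (a : Fin (m i j)), shift a c = 0 := by
  simp [dualPiece]

lemma mem_dualPiece_succ {hsymm : ∀ i j, m i j = m j i} {d : ℕ} {i : ι} {c : PathFun K m i} :
    c ∈ dualPiece K hsymm (d + 1) i ↔ evalNil i c = 0 ∧ relMap hsymm i c = 0 ∧
      ∀ j (a : Fin (m i j)), shift a c ∈ dualPiece K hsymm d j := by
  simp [dualPiece, and_assoc]

/-- Families of elements of the degree `d` pieces, indexed by the arrows starting at `i`, as
functions on paths starting at `i`. -/
def consPiece (K : Type) [Field K] (hsymm : ∀ i j, m i j = m j i) (d : ℕ) (i : ι) :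
    (∀ j, Fin (m i j) → dualPiece K hsymm d j) →ₗ[K] PathFun K m i :=
  consLin i ∘ₗ LinearMap.pi fun j => LinearMap.pi fun a =>
    (dualPiece K hsymm d j).subtype ∘ₗ LinearMap.proj a ∘ₗ LinearMap.proj j

lemma shift_consPiece {hsymm : ∀ i j, m i j = m j i} {d : ℕ} {i j : ι}
    (t : ∀ j, Fin (m i j) → dualPiece K hsymm d j) (a : Fin (m i j)) :
    shift a (consPiece K hsymm d i t) = t j a := rfl

lemma evalNil_consPiece {hsymm : ∀ i j, m i j = m j i} {d : ℕ} {i : ι}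
    (t : ∀ j, Fin (m i j) → dualPiece K hsymm d j) :
    evalNil i (consPiece K hsymm d i t) = 0 := rfl

lemma consPiece_injective (hsymm : ∀ i j, m i j = m j i) (d : ℕ) (i : ι) :
    Function.Injective (consPiece K hsymm d i) := by
  intro t t' h
  funext j a
  exact Subtype.ext (congrArg (shift a) h)

lemma dualPiece_succ_le_range (hsymm : ∀ i j, m i j = m j i) (d : ℕ) (i : ι) :
    dualPiece K hsymm (d + 1) i ≤ LinearMap.range (consPiece K hsymm d i) := by
  intro c hc
  rw [mem_dualPiece_succ] at hc
  exact ⟨fun j a => ⟨shift a c, hc.2.2 j a⟩, PathFun.ext_shift hc.1.symm fun j a => rfl⟩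

instance dualPiece_finite (hsymm : ∀ i j, m i j = m j i) (d : ℕ) (i : ι) :
    FiniteDimensional K (dualPiece K hsymm d i) := by
  induction d generalizing i with
  | zero =>
    refine FiniteDimensional.of_injective
      (evalNil i ∘ₗ (dualPiece K hsymm 0 i).subtype) fun c c' h => ?_
    refine Subtype.ext (PathFun.ext_shift h fun j a => ?_)
    rw [mem_dualPiece_zero.1 c.2, mem_dualPiece_zero.1 c'.2]
  | succ d ih => exact Submodule.finiteDimensional_of_le (dualPiece_succ_le_range hsymm d i)

lemma dualPiece_zero_pos (hsymm : ∀ i j, m i j = m j i) (i : ι) :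
    0 < Module.finrank K (dualPiece K hsymm 0 i) := by
  rw [Module.finrank_pos_iff_exists_ne_zero]
  refine ⟨⟨(1 : PreE K m).coeff i, mem_dualPiece_zero.2 fun j a => rfl⟩, fun h => ?_⟩
  exact one_ne_zero (α := K) (congrArg (evalNil i) (congrArg Subtype.val h))

lemma dualPiece_succ_eq_bot (hsymm : ∀ i j, m i j = m j i) {d : ℕ}
    (h : ∀ i, dualPiece K hsymm d i = ⊥) (i : ι) : dualPiece K hsymm (d + 1) i = ⊥ := by
  rw [eq_bot_iff]
  intro c hc
  rw [mem_dualPiece_succ] at hc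
  refine PathFun.ext_shift hc.1 fun j a => ?_
  have := hc.2.2 j a
  rwa [h, Submodule.mem_bot] at this

lemma finrank_consPiece (hsymm : ∀ i j, m i j = m j i) (d : ℕ) (i : ι) :
    Module.finrank K (∀ j, Fin (m i j) → dualPiece K hsymm d j) =
      ∑ j, m i j * Module.finrank K (dualPiece K hsymm d j) := by
  rw [Module.finrank_pi_fintype]
  refine Finset.sum_congr rfl fun j _ => ?_
  rw [Module.finrank_pi_fintype, Finset.sum_const, Finset.card_univ, Fintype.card_fin,
    smul_eq_mul]

/-- The degree `d + 1` piece is the kernel of the contraction with the preprojective relation. -/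
lemma finrank_ker_relMap_le (hsymm : ∀ i j, m i j = m j i) (d : ℕ) (i : ι) :
    Module.finrank K (LinearMap.ker (relMap hsymm i ∘ₗ consPiece K hsymm d i)) ≤
      Module.finrank K (dualPiece K hsymm (d + 1) i) := by
  let φ : LinearMap.ker (relMap hsymm i ∘ₗ consPiece K hsymm d i) →ₗ[K]
      dualPiece K hsymm (d + 1) i :=
    LinearMap.codRestrict _ (consPiece K hsymm d i ∘ₗ Submodule.subtype _) fun t =>
      mem_dualPiece_succ.2 ⟨evalNil_consPiece t.1, t.2, fun j a => (t.1 j a).2⟩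
  refine LinearMap.finrank_le_finrank_of_injective (f := φ) fun t t' h => ?_
  exact Subtype.ext (consPiece_injective hsymm d i (congrArg Subtype.val h))

lemma finrank_dualPiece_one (hsymm : ∀ i j, m i j = m j i) (i : ι) :
    ∑ j, m i j * Module.finrank K (dualPiece K hsymm 0 j) ≤
      Module.finrank K (dualPiece K hsymm 1 i) := by
  have h : relMap hsymm i ∘ₗ consPiece K hsymm 0 i = 0 := by
    refine LinearMap.ext fun t => ?_
    rw [LinearMap.comp_apply, relMap_apply]
    refine Finset.sum_eq_zero fun j _ => Finset.sum_eq_zero fun a _ => ?_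
    rw [shift_consPiece, mem_dualPiece_zero.1 (t j a).2, smul_zero]
  have h' := finrank_ker_relMap_le (K := K) hsymm 0 i
  rwa [h, LinearMap.ker_zero, finrank_top, finrank_consPiece] at h'

lemma finrank_dualPiece_succ_succ (hsymm : ∀ i j, m i j = m j i) (d : ℕ) (i : ι) :
    ∑ j, m i j * Module.finrank K (dualPiece K hsymm (d + 1) j) ≤
      Module.finrank K (dualPiece K hsymm (d + 2) i) +
        Module.finrank K (dualPiece K hsymm d i) := by
  have hr : LinearMap.range (relMap hsymm i ∘ₗ consPiece K hsymm (d + 1) i) ≤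
      dualPiece K hsymm d i := by
    rintro _ ⟨t, rfl⟩
    rw [LinearMap.comp_apply, relMap_apply]
    refine Submodule.sum_mem _ fun j _ => Submodule.sum_mem _ fun a _ =>
      Submodule.smul_mem _ _ ?_
    rw [shift_consPiece]
    exact (mem_dualPiece_succ.1 (t j a).2).2.2 i _
  have h1 := Submodule.finrank_mono hr
  have h2 : _ ≤ Module.finrank K (dualPiece K hsymm (d + 2) i) :=
    finrank_ker_relMap_le (K := K) hsymm (d + 1) i
  have h3 := LinearMap.finrank_range_add_finrank_ker
    (relMap hsymm i ∘ₗ consPiece K hsymm (d + 1) i)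
  rw [finrank_consPiece] at h3
  omega

/-- For an infinite Coxeter group the preprojective algebra is nonzero in every degree. -/
theorem exists_dualPiece_ne_bot (hsymm : ∀ i j, m i j = m j i)
    (hloop : ∀ i, m i i = 0) {Mc : CoxeterMatrix ι}
    (hMc : ∀ i j, i ≠ j → Mc i j = if m i j = 0 then 2 else if m i j = 1 then 3 else 0)
    (hinf : Infinite Mc.Group) (N : ℕ) : ∃ i, dualPiece K hsymm N i ≠ ⊥ := by
  by_contra! hN
  let r : ℕ → ι → ℕ := fun d i => Module.finrank K (dualPiece K hsymm d i)
  have hbot : ∀ n i, dualPiece K hsymm (N + n) i = ⊥ := by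
    intro n
    induction n with
    | zero => exact hN
    | succ n ih => exact dualPiece_succ_eq_bot hsymm ih
  have hzero : ∀ n i, r (N + n) i = 0 := fun n i =>
    Submodule.finrank_eq_zero.2 (hbot n i)
  have hpartial : ∀ n i, ∑ d ∈ Finset.range (n + 1), ∑ j, m i j * r d j + r 0 i ≤
      ∑ d ∈ Finset.range (n + 2), r d i + ∑ d ∈ Finset.range n, r d i := by
    intro n i
    induction n with
    | zero =>
      have := finrank_dualPiece_one (K := K) hsymm i
      simp only [Finset.sum_range_succ, Finset.sum_range_zero]
      simp only [r]
      omega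
    | succ n ih =>
      have h : ∑ j, m i j * r (n + 1) j ≤ r (n + 2) i + r n i :=
        finrank_dualPiece_succ_succ (K := K) hsymm n i
      rw [Finset.sum_range_succ (fun d => ∑ j, m i j * r d j) (n + 1),
        Finset.sum_range_succ (fun d => r d i) (n + 2), Finset.sum_range_succ (fun d => r d i) n]
      omega
  have hpos : ∀ i, 0 < r 0 i := dualPiece_zero_pos hsymm
  refine not_finite_iff_infinite.2 hinf (finite_coxeterGroup_of_pos hsymm hloop hMc
    (x := fun i => ∑ d ∈ Finset.range (N + 1), r d i) (fun i => ?_) fun i => ?_)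
  · exact (hpos i).trans_le (Finset.single_le_sum (f := fun d => r d i)
      (fun _ _ => Nat.zero_le _) (Finset.mem_range.2 N.succ_pos))
  · have h1 := hpartial N i
    have h2 := hpos i
    have h3 := hzero 1 i
    have h4 : ∑ j, m i j * ∑ d ∈ Finset.range (N + 1), r d j =
        ∑ d ∈ Finset.range (N + 1), ∑ j, m i j * r d j := by
      simp only [Finset.mul_sum]
      exact Finset.sum_comm
    rw [h4]
    rw [Finset.sum_range_succ _ (N + 1), h3] at h1
    have h5 := Finset.sum_range_succ (fun d => r d i) N
    omega

/-- The pairing of functions on paths starting at `i` over the paths of length `d`. -/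
def pairing : ℕ → ∀ i, PathFun K m i →ₗ[K] PathFun K m i →ₗ[K] K
  | 0, i => (LinearMap.mul K K).compl₁₂ (evalNil i) (evalNil i)
  | d + 1, i => ∑ j, ∑ a : Fin (m i j), (pairing d j).compl₁₂ (shift a) (shift a)

lemma pairing_zero {i : ι} (c F : PathFun K m i) :
    pairing 0 i c F = evalNil i c * evalNil i F := rfl

lemma pairing_succ {d : ℕ} {i : ι} (c F : PathFun K m i) :
    pairing (d + 1) i c F =
      ∑ j, ∑ a : Fin (m i j), pairing d j (shift a c) (shift a F) := by
  simp [pairing, LinearMap.sum_apply]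

/-- The pairing in degree `d` only depends on the values at paths of length at most `d`. -/
lemma pairing_eq_zero_of_len {d : ℕ} {i : ι} (c F : PathFun K m i)
    (hF : ∀ j (p : Pth m i j), p.len ≤ d → F j p = 0) : pairing d i c F = 0 := by
  induction d generalizing i with
  | zero =>
    rw [pairing_zero, show evalNil i F = 0 from hF i (.nil i) le_rfl, mul_zero]
  | succ d ih =>
    rw [pairing_succ]
    refine Finset.sum_eq_zero fun j _ => Finset.sum_eq_zero fun a _ => ih _ _ fun k p hp => ?_
    exact hF k (.cons a p) (Nat.succ_le_succ hp)

lemma evalNil_go (g : ∀ i j : ι, Pth m i j → K) {i : ι} (F : PathFun K m i) :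
    evalNil i (go g i F) = evalNil i F * evalNil i (g i) := rfl

lemma shift_go (g : ∀ i j : ι, Pth m i j → K) {i j : ι} (F : PathFun K m i) (a : Fin (m i j)) :
    shift a (go g i F) = evalNil i F • shift a (g i) + go g j (shift a F) := rfl

lemma go_eq_zero_of_right {g : ∀ i j : ι, Pth m i j → K} {n : ℕ}
    (hg : ∀ i j (p : Pth m i j), p.len < n → g i j p = 0) {i k : ι} (F : PathFun K m i)
    (p : Pth m i k) (hp : p.len < n) : go g i F k p = 0 := by
  induction p with
  | nil i => rw [go, hg _ _ _ hp, mul_zero]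
  | cons a p ih =>
    rw [go, hg _ _ _ hp, mul_zero, zero_add]
    exact ih _ ((Nat.lt_succ_self _).trans hp)

lemma go_eq_zero_of_left (g : ∀ i j : ι, Pth m i j → K) {i k : ι} (F : PathFun K m i)
    (p : Pth m i k) (hF : ∀ j (q : Pth m i j), q.len ≤ p.len → F j q = 0) :
    go g i F k p = 0 := by
  induction p with
  | nil i => rw [go, hF _ _ le_rfl, zero_mul]
  | cons a p ih =>
    rw [go, hF _ (.nil _) (Nat.zero_le _), zero_mul, zero_add]
    exact ih _ fun j q hq => hF j (.cons a q) (Nat.succ_le_succ hq)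

lemma rho_coeff_nil (i : ι) : evalNil i ((rho K m).coeff i) = 0 := rfl

lemma rho_coeff_arrow {i j : ι} (a : Fin (m i j)) :
    evalNil j (shift a ((rho K m).coeff i)) = 0 := rfl

lemma shift_shift_rho_mul (g : PreE K m) {i j k : ι} (a : Fin (m i j)) (b : Fin (m j k)) :
    shift b (shift a ((rho K m * g).coeff i)) =
      (if k = i then (if (a : ℕ) = (b : ℕ) then arrowSign K i j else 0) else 0) •
        g.coeff k := by
  rw [PreE.coeff_mul, shift_go, rho_coeff_nil, zero_smul, zero_add, shift_go, rho_coeff_arrow,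
    zero_smul, zero_add]
  funext l p
  refine (go_congrF g.coeff (F' := fun l q =>
    (if k = i then (if (a : ℕ) = (b : ℕ) then arrowSign K i j else 0) else 0) *
      (1 : PreE K m).coeff k l q) ?_ p).trans
    ((go_mulF g.coeff _ _ p).trans (congrArg _ (go_oneF g.coeff p)))
  intro l q
  cases q with
  | nil => exact (mul_one _).symm
  | cons => exact (mul_zero _).symm

/-- Elements of the dual pieces vanish on the right ideal generated by the preprojective
relation. -/
lemma pairing_rho_mul {hsymm : ∀ i j, m i j = m j i} {d : ℕ} {i : ι} {c : PathFun K m i}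
    (hc : c ∈ dualPiece K hsymm d i) (g : PreE K m) :
    pairing d i c ((rho K m * g).coeff i) = 0 := by
  have hnil : evalNil i ((rho K m * g).coeff i) = 0 := by
    rw [PreE.coeff_mul, evalNil_go, rho_coeff_nil, zero_mul]
  match d, hc with
  | 0, _ => rw [pairing_zero, hnil, mul_zero]
  | 1, _ =>
    rw [pairing_succ]
    refine Finset.sum_eq_zero fun j _ => Finset.sum_eq_zero fun a _ => ?_
    rw [pairing_zero, PreE.coeff_mul, shift_go, rho_coeff_nil, zero_smul, zero_add, evalNil_go,
      rho_coeff_arrow, zero_mul, mul_zero]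
  | d + 2, hc =>
    have hrel := (mem_dualPiece_succ.1 hc).2.1
    rw [relMap_apply] at hrel
    have h := congrArg (fun c' => pairing d i c' (g.coeff i)) hrel
    simp only [map_sum, map_smul, LinearMap.sum_apply, LinearMap.smul_apply, map_zero,
      LinearMap.zero_apply] at h
    rw [pairing_succ, ← h]
    refine Finset.sum_congr rfl fun j _ => Finset.sum_congr rfl fun a _ => ?_
    rw [pairing_succ, Finset.sum_eq_single i, Finset.sum_eq_single (Fin.cast (hsymm i j) a)]
    · rw [shift_shift_rho_mul, if_pos rfl,
        if_pos (show (a : ℕ) = (Fin.cast (hsymm i j) a : ℕ) from rfl), map_smul]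
    · intro b _ hb
      rw [shift_shift_rho_mul, if_pos rfl, if_neg fun h => hb (Fin.ext h.symm), zero_smul,
        map_zero]
    · simp
    · intro k _ hk
      refine Finset.sum_eq_zero fun b _ => ?_
      rw [shift_shift_rho_mul, if_neg hk, zero_smul, map_zero]
    · simp

/-- Elements of the dual pieces vanish on all left multiples of `g` once they vanish on `g`. -/
lemma pairing_go_eq_zero {hsymm : ∀ i j, m i j = m j i} {g : PreE K m}
    (hg : ∀ d i, ∀ c ∈ dualPiece K hsymm d i, pairing d i c (g.coeff i) = 0) {d : ℕ} {i : ι}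
    {c : PathFun K m i} (hc : c ∈ dualPiece K hsymm d i) (F : PathFun K m i) :
    pairing d i c (go g.coeff i F) = 0 := by
  induction d generalizing i with
  | zero =>
    have := hg 0 i c hc
    rw [pairing_zero] at this ⊢
    rw [evalNil_go, mul_left_comm, this, mul_zero]
  | succ d ih =>
    have := hg (d + 1) i c hc
    rw [pairing_succ] at this ⊢
    simp only [shift_go, map_add, map_smul, ih ((mem_dualPiece_succ.1 hc).2.2 _ _), add_zero,
      ← Finset.smul_sum, this, smul_zero]

/-- The two-sided ideal of elements all of whose two-sided multiples are annihilated by the dual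
pieces. -/
def dualAnnihilator (K : Type) [Field K] (hsymm : ∀ i j, m i j = m j i) :
    TwoSidedIdeal (PreE K m) :=
  TwoSidedIdeal.mk'
    {f | ∀ (a b : PreE K m) (d : ℕ) (i : ι), ∀ c ∈ dualPiece K hsymm d i,
      pairing d i c ((a * f * b).coeff i) = 0}
    (fun a b d i c _ => by rw [mul_zero, zero_mul, PreE.coeff_zero, map_zero])
    (fun {x y} hx hy a b d i c hc => by
      rw [mul_add, add_mul, PreE.coeff_add, map_add, hx a b d i c hc, hy a b d i c hc, add_zero])
    (fun {x} hx a b d i c hc => by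
      rw [mul_neg, neg_mul, PreE.coeff_neg, map_neg, hx a b d i c hc, neg_zero])
    (fun {x y} hy a b d i c hc => by
      rw [← mul_assoc]
      exact hy (a * x) b d i c hc)
    (fun {x y} hx a b d i c hc => by
      rw [mul_assoc, mul_assoc, ← mul_assoc a x]
      exact hx a (y * b) d i c hc)

lemma mem_dualAnnihilator {hsymm : ∀ i j, m i j = m j i} {f : PreE K m} :
    f ∈ dualAnnihilator K hsymm ↔ ∀ (a b : PreE K m) (d : ℕ) (i : ι),
      ∀ c ∈ dualPiece K hsymm d i, pairing d i c ((a * f * b).coeff i) = 0 :=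
  TwoSidedIdeal.mem_mk' _ _ _ _ _ _ _

lemma relIdeal_le_dualAnnihilator (hsymm : ∀ i j, m i j = m j i) :
    relIdeal K m ≤ dualAnnihilator K hsymm := by
  refine TwoSidedIdeal.span_le.2 (Set.singleton_subset_iff.2 ?_)
  refine mem_dualAnnihilator.2 fun a b d i c hc => ?_
  rw [mul_assoc, PreE.coeff_mul]
  exact pairing_go_eq_zero (fun d i c hc => pairing_rho_mul hc b) hc _

lemma relClosure_subset_dualAnnihilator (hsymm : ∀ i j, m i j = m j i) {f : PreE K m}
    (hf : f ∈ relClosure K m) : f ∈ dualAnnihilator K hsymm := by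
  refine mem_dualAnnihilator.2 fun a b d i c hc => ?_
  obtain ⟨g, hg, hfg⟩ := hf (d + 1)
  have hg' := mem_dualAnnihilator.1 (relIdeal_le_dualAnnihilator hsymm hg) a b d i c hc
  have hsub : ∀ i j (p : Pth m i j), p.len < d + 1 → (f - g).coeff i j p = 0 := by
    intro i j p hp
    rw [sub_eq_add_neg]
    change f.coeff i j p + -g.coeff i j p = 0
    rw [hfg i j p hp, add_neg_cancel]
  have hdiff : pairing d i c ((a * (f - g) * b).coeff i) = 0 := by
    refine pairing_eq_zero_of_len _ _ fun j p hp => ?_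
    refine go_eq_zero_of_left _ _ _ fun k q hq => ?_
    exact go_eq_zero_of_right hsub _ _ (Nat.lt_succ_of_le (hq.trans hp))
  have hsplit : a * f * b = a * (f - g) * b + a * g * b := by
    rw [← add_mul, ← mul_add, sub_add_cancel]
  rw [hsplit, PreE.coeff_add, map_add, hdiff, hg', add_zero]

/-- An element of the complete path algebra that pairs nontrivially with a dual piece is nonzero
in the complete preprojective algebra. -/
lemma mk_ne_zero_of_pairing_ne_zero {hsymm : ∀ i j, m i j = m j i} {f : PreE K m} {d : ℕ} {i : ι}
    {c : PathFun K m i} (hc : c ∈ dualPiece K hsymm d i) (h : pairing d i c (f.coeff i) ≠ 0) :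
    ((ppCon K m).mk' f : PPA K m) ≠ 0 := by
  intro h0
  have hle : ppCon K m ≤ (dualAnnihilator K hsymm).ringCon := by
    refine RingCon.ringConGen_le.2 fun x y hxy => ?_
    exact (TwoSidedIdeal.rel_iff _ _ _).2 (relClosure_subset_dualAnnihilator hsymm hxy)
  have hf : ppCon K m f 0 := (RingCon.eq _).1 h0
  have hmem : f ∈ dualAnnihilator K hsymm := hle hf
  have := mem_dualAnnihilator.1 hmem 1 1 d i c hc
  rw [one_mul, mul_one] at this
  exact h this

/-- The path of length one given by an arrow, in the complete path algebra. -/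
def arrow {i j : ι} (a : Fin (m i j)) : PreE K m :=
  ⟨Pi.single i (consFun (Pi.single j (Pi.single a ((1 : PreE K m).coeff j))))⟩

/-- The trivial path at `i`, in the complete path algebra. -/
def trivialPath (K : Type) [Field K] (m : ι → ι → ℕ) (i : ι) : PreE K m :=
  ⟨fun _ _ p => match p with
    | .nil v => if v = i then (1 : K) else 0
    | .cons _ _ => 0⟩

lemma go_one_coeff (f : PreE K m) (i : ι) :
    go f.coeff i ((1 : PreE K m).coeff i) = f.coeff i :=
  funext fun _ => funext fun p => go_oneF f.coeff p

lemma go_zero (g : ∀ i j : ι, Pth m i j → K) (i : ι) : go g i (0 : PathFun K m i) = 0 :=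
  funext fun _ => funext fun p => go_zeroF g p

lemma arrow_mul_coeff_self {i j : ι} (a : Fin (m i j)) (f : PreE K m) :
    (arrow a * f).coeff i = consFun (Pi.single j (Pi.single a (f.coeff j))) := by
  have hcoeff : (arrow a : PreE K m).coeff i =
      consFun (Pi.single j (Pi.single a ((1 : PreE K m).coeff j))) := Pi.single_eq_same _ _
  rw [PreE.coeff_mul, hcoeff]
  refine PathFun.ext_shift (zero_mul _) fun k b => ?_
  rw [shift_go, show evalNil i (consFun (Pi.single j (Pi.single a ((1 : PreE K m).coeff j)))) = 0
    from rfl, zero_smul, zero_add]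
  change go f.coeff k
    ((Pi.single j (Pi.single a ((1 : PreE K m).coeff j)) : ∀ j, Fin (m i j) → PathFun K m j) k b) =
      (Pi.single j (Pi.single a (f.coeff j)) : ∀ j, Fin (m i j) → PathFun K m j) k b
  by_cases hk : k = j
  · subst hk
    rw [Pi.single_eq_same, Pi.single_eq_same]
    by_cases hb : b = a
    · subst hb
      rw [Pi.single_eq_same, Pi.single_eq_same, go_one_coeff]
    · rw [Pi.single_eq_of_ne hb, Pi.single_eq_of_ne hb, go_zero]
  · rw [Pi.single_eq_of_ne hk, Pi.single_eq_of_ne hk]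
    exact go_zero _ _

lemma arrow_mul_coeff_of_ne {i j k : ι} (hk : k ≠ i) (a : Fin (m i j)) (f : PreE K m) :
    (arrow a * f).coeff k = 0 := by
  rw [PreE.coeff_mul, show (arrow a : PreE K m).coeff k = 0 from Pi.single_eq_of_ne hk _, go_zero]

lemma pairing_arrow_mul {d : ℕ} {i j : ι} (c : PathFun K m i) (a : Fin (m i j)) (f : PreE K m) :
    pairing (d + 1) i c ((arrow a * f).coeff i) = pairing d j (shift a c) (f.coeff j) := by
  have hshift {k : ι} (t : ∀ j, Fin (m i j) → PathFun K m j) (b : Fin (m i k)) :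
      shift b (consFun t) = t k b := rfl
  rw [arrow_mul_coeff_self, pairing_succ, Finset.sum_eq_single j, Finset.sum_eq_single a]
  · rw [hshift, Pi.single_eq_same, Pi.single_eq_same]
  · intro b _ hb
    rw [hshift, Pi.single_eq_same, Pi.single_eq_of_ne hb, map_zero]
  · simp
  · intro k _ hk
    refine Finset.sum_eq_zero fun b _ => ?_
    rw [hshift, Pi.single_eq_of_ne hk, Pi.zero_apply, map_zero]
  · simp

lemma arrow_mul_trivialPath {i j k : ι} (hk : j ≠ k) (a : Fin (m i j)) :
    arrow a * trivialPath K m k = 0 := by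
  ext l : 2
  by_cases hl : l = i
  · subst hl
    have h0 : (trivialPath K m k).coeff j = 0 := by
      funext _ p
      cases p with
      | nil => exact if_neg hk
      | cons => rfl
    rw [arrow_mul_coeff_self, h0, Pi.single_zero, Pi.single_zero]
    exact PathFun.ext_shift rfl fun _ _ => rfl
  · exact arrow_mul_coeff_of_ne hl a _

lemma trivialPath_mul_arrow {i j k : ι} (hk : i ≠ k) (a : Fin (m i j)) :
    trivialPath K m k * arrow a = 0 := by
  ext l : 2
  rw [PreE.coeff_mul]
  have hshift {l' : ι} (b : Fin (m l l')) : shift b ((trivialPath K m k).coeff l) = 0 := rfl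
  have hnil : evalNil l ((trivialPath K m k).coeff l) = if l = k then 1 else 0 := rfl
  by_cases hl : l = i
  · subst hl
    refine PathFun.ext_shift ?_ fun l' b => ?_
    · rw [evalNil_go, hnil, if_neg hk, zero_mul]
      rfl
    · rw [shift_go, hnil, if_neg hk, zero_smul, zero_add, hshift, go_zero]
      rfl
  · have h0 : (arrow a : PreE K m).coeff l = 0 := Pi.single_eq_of_ne hl _
    refine PathFun.ext_shift ?_ fun l' b => ?_
    · rw [evalNil_go, h0, map_zero, mul_zero]
      rfl
    · rw [shift_go, h0, map_zero, smul_zero, zero_add, hshift, go_zero]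
      rfl

/-- Every arrow lies in every ideal `I_k`, since the graph has no loops. -/
lemma mk_arrow_mem_Igen (hloop : ∀ i, m i i = 0) (k : ι) {i j : ι} (a : Fin (m i j)) :
    ((ppCon K m).mk' (arrow a) : PPA K m) ∈ Igen K m k := by
  have hgen : ((ppCon K m).mk' (1 - trivialPath K m k) : PPA K m) ∈ Igen K m k :=
    TwoSidedIdeal.subset_span (map_sub (ppCon K m).mk' 1 (trivialPath K m k))
  by_cases hi : i = k
  · have hj : j ≠ k := by
      rintro rfl
      subst hi
      exact (Fin.cast (hloop i) a).elim0
    have h := TwoSidedIdeal.mul_mem_left _ ((ppCon K m).mk' (arrow a) : PPA K m) _ hgen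
    have heq : arrow a * (1 - trivialPath K m k) = arrow a := by
      rw [mul_sub, mul_one, arrow_mul_trivialPath hj, sub_zero]
    rw [← heq]
    exact (map_mul (ppCon K m).mk' _ _).symm ▸ h
  · have h := TwoSidedIdeal.mul_mem_right _ _ ((ppCon K m).mk' (arrow a) : PPA K m) hgen
    have heq : (1 - trivialPath K m k) * arrow a = arrow a := by
      rw [sub_mul, one_mul, trivialPath_mul_arrow hi, sub_zero]
    rw [← heq]
    exact (map_mul (ppCon K m).mk' _ _).symm ▸ h

lemma exists_mem_prodI_pairing_ne_zero {hsymm : ∀ i j, m i j = m j i} (hloop : ∀ i, m i i = 0)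
    (l : List ι) {i : ι} {c : PathFun K m i} (hc : c ∈ dualPiece K hsymm l.length i)
    (hc0 : c ≠ 0) :
    ∃ x : PreE K m, ((ppCon K m).mk' x : PPA K m) ∈ prodI K m l ∧
      pairing l.length i c (x.coeff i) ≠ 0 := by
  induction l generalizing i with
  | nil =>
    refine ⟨1, trivial, fun h => hc0 ?_⟩
    rw [List.length_nil, pairing_zero,
      show evalNil i ((1 : PreE K m).coeff i) = 1 from rfl, mul_one] at h
    exact PathFun.ext_shift (h.trans (map_zero _).symm) fun j a =>
      (mem_dualPiece_zero.1 hc j a).trans (map_zero _).symm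
  | cons k l ih =>
    obtain ⟨hnil, -, hshift⟩ := mem_dualPiece_succ.1 hc
    obtain ⟨j, a, ha⟩ : ∃ j, ∃ a : Fin (m i j), shift a c ≠ 0 := by
      by_contra! h
      exact hc0 (PathFun.ext_shift (hnil.trans (map_zero _).symm) fun j a =>
        (h j a).trans (map_zero _).symm)
    obtain ⟨x, hx, hpair⟩ := ih (hshift j a) ha
    refine ⟨arrow a * x, TwoSidedIdeal.subset_span
      ⟨_, mk_arrow_mem_Igen hloop k a, _, hx, map_mul (ppCon K m).mk' _ _⟩, ?_⟩
    rw [List.length_cons, pairing_arrow_mul]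
    exact hpair

/-- The ideals `I_w` of a complete preprojective algebra of non-Dynkin type are nonzero. -/
theorem exists_mem_prodI_ne_zero (hsymm : ∀ i j, m i j = m j i) (hloop : ∀ i, m i i = 0)
    {Mc : CoxeterMatrix ι}
    (hMc : ∀ i j, i ≠ j → Mc i j = if m i j = 0 then 2 else if m i j = 1 then 3 else 0)
    (hinf : Infinite Mc.Group) (l : List ι) : ∃ y ∈ prodI K m l, y ≠ 0 := by
  obtain ⟨i, hi⟩ := exists_dualPiece_ne_bot (K := K) hsymm hloop hMc hinf l.length
  obtain ⟨c, hc, hc0⟩ := Submodule.exists_mem_ne_zero_of_ne_bot hi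
  obtain ⟨x, hx, hpair⟩ := exists_mem_prodI_pairing_ne_zero hloop l hc hc0
  exact ⟨_, hx, mk_ne_zero_of_pairing_ne_zero hc hpair⟩

end PathFunctionals

section TwoTermKernel

variable {Λ : Type} [Ring Λ]

/-- If the differential of a two-term complex is injective, so is that of any homotopy equivalent
two-term complex. -/
lemma TwoTermHtpyEquiv.injective {A1 A0 B1 B0 : Type}
    [AddCommGroup A1] [Module Λ A1] [AddCommGroup A0] [Module Λ A0]
    [AddCommGroup B1] [Module Λ B1] [AddCommGroup B0] [Module Λ B0]
    {dA : A1 →ₗ[Λ] A0} {dB : B1 →ₗ[Λ] B0} (h : TwoTermHtpyEquiv Λ A1 A0 B1 B0 dA dB)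
    (hA : Function.Injective dA) : Function.Injective dB := by
  obtain ⟨u1, u0, v1, v0, s, t, -, hv, -, -, ht, -⟩ := h
  refine (injective_iff_map_eq_zero dB).2 fun x hx => ?_
  have hvx : v1 x = 0 := hA (by
    rw [map_zero, ← LinearMap.comp_apply, hv, LinearMap.comp_apply, hx, map_zero])
  have htx := LinearMap.congr_fun ht x
  simpa [hx, hvx] using htx

/-- If `g` presents a nonzero two-sided ideal as a right module, the dual of `g` has nonzero
kernel, containing the inclusion of the ideal. -/
lemma not_injective_dualMap {I : TwoSidedIdeal Λ} {y : Λ} (hy : y ∈ I) (hy0 : y ≠ 0)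
    {Q1 Q0 : Type} [AddCommGroup Q1] [Module Λᵐᵒᵖ Q1] [AddCommGroup Q0] [Module Λᵐᵒᵖ Q0]
    {g : Q1 →ₗ[Λᵐᵒᵖ] Q0} {qr : Q0 →ₗ[Λᵐᵒᵖ] (TwoSidedIdeal.asIdealOpposite I : Ideal Λᵐᵒᵖ)}
    (hexact : Function.Exact g qr) (hsurj : Function.Surjective qr) :
    ¬ Function.Injective (dualMap Λ g) := by
  intro hinj
  let φ : Q0 →ₗ[Λᵐᵒᵖ] Λ :=
    { toFun := fun q => (qr q : Λᵐᵒᵖ).unop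
      map_add' := fun p q => by simp
      map_smul' := fun r q => by simp }
  have hφ : φ = 0 := hinj (by
    rw [map_zero]
    ext q
    change (qr (g q) : Λᵐᵒᵖ).unop = 0
    rw [hexact.apply_apply_eq_zero]
    rfl)
  obtain ⟨q, hq⟩ := hsurj ⟨MulOpposite.op y, TwoSidedIdeal.mem_asIdealOpposite.2 hy⟩
  have hφq : φ q = y := congrArg MulOpposite.unop (congrArg Subtype.val hq)
  exact hy0 (by rw [← hφq, hφ, LinearMap.zero_apply])

end TwoTermKernel

/-- **Proposition 2.6.** Let `Λ` be the complete preprojective algebra of a (connected)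
non-Dynkin graph (equivalently the Coxeter group `W` is infinite) over an algebraically closed
field, `W` its Coxeter group and `I_w = I_{i_1} ⋯ I_{i_l}` for a reduced word of `w`.
Let `P_w = (P¹ → P⁰)` be a minimal projective presentation of `I_w` as a left `Λ`-module and
`R_v = Hom_{Λᵒᵖ}(Q_v, Λ[1])` the shifted dual of a minimal projective presentation
`Q_v = (Q¹ → Q⁰)` of `I_v` as a right `Λ`-module.  Then the two families are disjoint:
`P_w ≇ R_v` in `K^b(proj Λ)` for all `v, w ∈ W`. -/
theorem Pw_not_iso_Rv
    (K : Type) [Field K] [IsAlgClosed K]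
    {ι : Type} [Fintype ι] [LinearOrder ι] [Nonempty ι]
    (m : ι → ι → ℕ) (hsymm : ∀ i j, m i j = m j i) (hloop : ∀ i, m i i = 0)
    (hconn : (SimpleGraph.fromRel (fun i j => m i j ≠ 0)).Connected)
    (Mc : CoxeterMatrix ι)
    (hMc : ∀ i j, i ≠ j → Mc i j = if m i j = 0 then 2 else if m i j = 1 then 3 else 0)
    (hNonDynkin : Infinite Mc.Group) :
    ∀ (w v : Mc.Group) (lw lv : List ι),
      Mc.toCoxeterSystem.wordProd lw = w →
      lw.length = Mc.toCoxeterSystem.length w →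
      Mc.toCoxeterSystem.wordProd lv = v →
      lv.length = Mc.toCoxeterSystem.length v →
      ∀ (P1 P0 : Type) [AddCommGroup P1] [Module (PPA K m) P1]
        [AddCommGroup P0] [Module (PPA K m) P0],
      Module.Finite (PPA K m) P1 → Module.Projective (PPA K m) P1 →
      Module.Finite (PPA K m) P0 → Module.Projective (PPA K m) P0 →
      ∀ (f : P1 →ₗ[PPA K m] P0)
        (pr : P0 →ₗ[PPA K m] (TwoSidedIdeal.asIdeal (prodI K m lw) : Ideal (PPA K m))),
      -- minimal projective resolution of `I_w` as a left module
      Function.Injective f → Function.Exact f pr → Function.Surjective pr →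
      LinearMap.range f ≤ radSub (PPA K m) P0 →
      ∀ (Q1 Q0 : Type) [AddCommGroup Q1] [Module (PPA K m)ᵐᵒᵖ Q1]
        [AddCommGroup Q0] [Module (PPA K m)ᵐᵒᵖ Q0],
      Module.Finite (PPA K m)ᵐᵒᵖ Q1 → Module.Projective (PPA K m)ᵐᵒᵖ Q1 →
      Module.Finite (PPA K m)ᵐᵒᵖ Q0 → Module.Projective (PPA K m)ᵐᵒᵖ Q0 →
      ∀ (g : Q1 →ₗ[(PPA K m)ᵐᵒᵖ] Q0)
        (qr : Q0 →ₗ[(PPA K m)ᵐᵒᵖ]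
          (TwoSidedIdeal.asIdealOpposite (prodI K m lv) : Ideal (PPA K m)ᵐᵒᵖ)),
      -- minimal projective resolution of `I_v` as a right module
      Function.Injective g → Function.Exact g qr → Function.Surjective qr →
      LinearMap.range g ≤ radSub (PPA K m)ᵐᵒᵖ Q0 →
      -- `P_w` is not isomorphic to `R_v` in the homotopy category
      ¬ TwoTermHtpyEquiv (PPA K m) P1 P0
          (Q0 →ₗ[(PPA K m)ᵐᵒᵖ] PPA K m) (Q1 →ₗ[(PPA K m)ᵐᵒᵖ] PPA K m)
          f (dualMap (PPA K m) g) := by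
  intro w v lw lv _ _ _ _ P1 P0 _ _ _ _ _ _ _ _ f pr hf _ _ _ Q1 Q0 _ _ _ _ _ _ _ _ g qr _ hexact
    hsurj _ hiso
  obtain ⟨y, hy, hy0⟩ := exists_mem_prodI_ne_zero (K := K) hsymm hloop hMc hNonDynkin lv
  exact not_injective_dualMap hy hy0 hexact hsurj (hiso.injective hf)
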